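/- Let p be an odd prime, f : ℤ_p → ℤ_p continuous, λ ∈ ℚ_p with ‖λ‖_p > 1, and s ∈ ℤ_p. Then all fermionic integrals E_m^f(0) := ∫_{ℤ_p} f(a)^m dμ_{−1}(a) exist, the fermionic integral ζ_{p,E}^f(s,λ) = ∫_{ℤ_p} ⟨λ+f(a)⟩^{1−s} dμ_{−1}(a) exists, the series Σ_{m=0}^∞ C(1−s,m)·E_m^f(0)·λ^{−m} converges, and ζ_{p,E}^f(s,λ) = ⟨λ⟩^{1−s}·Σ_{m=0}^∞ C(1−s,m)·E_m^f(0)·λ^{−m}. -/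

import Mathlib

open Filter Topology

namespace PZeta

variable (p : ℕ) [Fact p.Prime]

/-- The `N`-th partial sum defining the fermionic integral
`∫_{ℤ_p} g dμ₋₁ = lim_N Σ_{a=0}^{p^N-1} (-1)^a g(a)`. -/
noncomputable def fermSum (g : ℤ_[p] → ℚ_[p]) (N : ℕ) : ℚ_[p] :=
  ∑ a ∈ Finset.range (p ^ N), (-1 : ℚ_[p]) ^ a * g (a : ℤ_[p])

/-- The `N`-th partial sum defining the Volkenborn integral
`∫_{ℤ_p} g da = lim_N p^{-N} Σ_{a=0}^{p^N-1} g(a)`. -/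
noncomputable def volkSum (g : ℤ_[p] → ℚ_[p]) (N : ℕ) : ℚ_[p] :=
  ((p : ℚ_[p]) ^ N)⁻¹ * ∑ a ∈ Finset.range (p ^ N), g (a : ℤ_[p])

/-- The unit part `x·p^{-v_p(x)}` of a nonzero `p`-adic number. -/
noncomputable def unitPart (x : ℚ_[p]) : ℚ_[p] := x * (p : ℚ_[p]) ^ (-x.valuation)

/-- The Teichmüller representative of a `p`-adic unit, `lim_n x^{p^n}`. -/
noncomputable def teich (x : ℚ_[p]) : ℚ_[p] :=
  limUnder atTop fun n : ℕ => x ^ p ^ n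

/-- The projection `⟨x⟩ ∈ 1 + pℤ_p`, via `x = p^{v_p(x)}·ζ·⟨x⟩`. -/
noncomputable def angle (x : ℚ_[p]) : ℚ_[p] := unitPart p x / teich p (unitPart p x)

/-- `ω_v(x) := x / ⟨x⟩ = p^{v_p(x)}·ζ`. -/
noncomputable def omegaV (x : ℚ_[p]) : ℚ_[p] := x / angle p x

/-- The generalized binomial coefficient `C(t,n) = t(t-1)⋯(t-n+1)/n!`. -/
noncomputable def gbinom (t : ℚ_[p]) (n : ℕ) : ℚ_[p] :=
  (∏ i ∈ Finset.range n, (t - (i : ℚ_[p]))) / (n.factorial : ℚ_[p])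

/-- The power `y^t` defined by the binomial series `Σ_n C(t,n)(y-1)^n`
(used for `y ∈ 1 + pℤ_p` and `t ∈ ℤ_p`). -/
noncomputable def bpow (y t : ℚ_[p]) : ℚ_[p] := ∑' n : ℕ, gbinom p t n * (y - 1) ^ n

/-- The Iwasawa `p`-adic logarithm: `log_p x = Σ_{n≥1} (-1)^{n+1}(⟨x⟩-1)^n/n`
(one has `log_p p = 0` and `log_p ζ = 0` for roots of unity of order prime to `p`). -/
noncomputable def padicLog (x : ℚ_[p]) : ℚ_[p] :=
  ∑' n : ℕ, (-1 : ℚ_[p]) ^ n * (angle p x - 1) ^ (n + 1) / ((n : ℚ_[p]) + 1)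

/-- The power `y^t` defined by the exponential series `Σ_n (t·log_p y)^n/n!`
(used for `y ∈ 1 + pℤ_p` and `‖t‖ < p^{(p-2)/(p-1)}`). -/
noncomputable def epow (y t : ℚ_[p]) : ℚ_[p] :=
  ∑' n : ℕ, (t * padicLog p y) ^ n / (n.factorial : ℚ_[p])

/-- `f : ℤ_p → ℤ_p` is everywhere analytic with integral coefficients:
`f(x) = Σ_k c_k x^k` with `‖c_k‖ ≤ 1`, `c_k → 0`. -/
def EverywhereAnalytic (f : ℤ_[p] → ℤ_[p]) : Prop :=
  ∃ c : ℕ → ℚ_[p], (∀ k, ‖c k‖ ≤ 1) ∧ Tendsto c atTop (𝓝 0) ∧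
    ∀ x : ℤ_[p], (f x : ℚ_[p]) = ∑' k : ℕ, c k * (x : ℚ_[p]) ^ k

/-- The `p`-adic Hurwitz-type Euler zeta function w.r.t. `f`:
`ζ_{p,E}^f(s,λ) = ∫_{ℤ_p} ⟨λ+f(a)⟩^{1-s} dμ₋₁(a)`. -/
noncomputable def zetaE (f : ℤ_[p] → ℤ_[p]) (s : ℤ_[p]) (lam : ℚ_[p]) : ℚ_[p] :=
  limUnder atTop
    (fermSum p fun a => bpow p (angle p (lam + (f a : ℚ_[p]))) (1 - (s : ℚ_[p])))

/-- The `p`-adic Hurwitz zeta function w.r.t. `f`: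
`ζ_p^f(s,λ) = (s-1)⁻¹ ∫_{ℤ_p} ⟨λ+f(a)⟩^{1-s} da`. -/
noncomputable def zetaH (f : ℤ_[p] → ℤ_[p]) (s : ℤ_[p]) (lam : ℚ_[p]) : ℚ_[p] :=
  ((s : ℚ_[p]) - 1)⁻¹ *
    limUnder atTop
      (volkSum p fun a => bpow p (angle p (lam + (f a : ℚ_[p]))) (1 - (s : ℚ_[p])))

end PZeta

namespace PZeta

section FermionicIntegral

open Finset

variable {p : ℕ} [Fact p.Prime]

/-- Splitting a fermionic sum of length `n * m`, with `n` odd, into `m` blocks of length `n`. -/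
lemma sum_range_mul_neg_one_pow {R : Type*} [CommRing R] {n : ℕ} (hn : Odd n) (m : ℕ)
    (F : ℕ → R) :
    ∑ a ∈ range (n * m), (-1 : R) ^ a * F a =
      ∑ c ∈ range m, (-1 : R) ^ c * ∑ b ∈ range n, (-1 : R) ^ b * F (n * c + b) := by
  induction m with
  | zero => simp
  | succ m ih =>
    rw [Nat.mul_succ, sum_range_add, ih, sum_range_succ]
    congr 1
    rw [mul_sum]
    refine sum_congr rfl fun b _ => ?_
    rw [pow_add, pow_mul, hn.neg_one_pow, mul_assoc]

lemma norm_neg_one_pow_mul (n : ℕ) (x : ℚ_[p]) : ‖(-1 : ℚ_[p]) ^ n * x‖ = ‖x‖ := by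
  simp

lemma norm_fermSum_le {g : ℤ_[p] → ℚ_[p]} {C : ℝ} (hC : 0 ≤ C) (hg : ∀ a, ‖g a‖ ≤ C) (N : ℕ) :
    ‖fermSum p g N‖ ≤ C :=
  IsUltrametricDist.norm_sum_le_of_forall_le_of_nonneg hC fun a _ => by
    rw [norm_neg_one_pow_mul]; exact hg _

lemma fermSum_succ_sub (hp : Odd p) (g : ℤ_[p] → ℚ_[p]) (N : ℕ) :
    fermSum p g (N + 1) - fermSum p g N =
      ∑ c ∈ range p, (-1 : ℚ_[p]) ^ c * ∑ b ∈ range (p ^ N),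
        (-1 : ℚ_[p]) ^ b * (g ((p : ℤ_[p]) ^ N * c + b) - g b) := by
  have h1 : ∑ c ∈ range p, (-1 : ℚ_[p]) ^ c = 1 := by
    rw [neg_one_geom_sum, if_neg (Nat.not_even_iff_odd.mpr hp)]
  have h2 := sum_range_mul_neg_one_pow (R := ℚ_[p]) (hp.pow (n := N)) p fun a => g (a : ℤ_[p])
  simp only [fermSum, pow_succ, mul_sub, sum_sub_distrib]
  rw [h2, ← sum_mul, h1, one_mul]
  simp

/-- The fermionic integral of a continuous function exists. -/
lemma exists_tendsto_fermSum (hp : Odd p) {g : ℤ_[p] → ℚ_[p]} (hg : Continuous g) :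
    ∃ I, Tendsto (fermSum p g) atTop (𝓝 I) := by
  apply cauchySeq_tendsto_of_complete
  apply NonarchimedeanAddGroup.cauchySeq_of_tendsto_sub_nhds_zero
  rw [Metric.tendsto_atTop]
  intro ε hε
  obtain ⟨δ, hδ, h⟩ := Metric.uniformContinuous_iff.mp
    (CompactSpace.uniformContinuous_of_continuous hg) (ε / 2) (half_pos hε)
  obtain ⟨M, hM⟩ := PadicInt.exists_pow_neg_lt p hδ
  refine ⟨M, fun N hN => ?_⟩
  rw [dist_zero_right, fermSum_succ_sub hp]
  refine lt_of_le_of_lt ?_ (half_lt_self hε)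
  refine IsUltrametricDist.norm_sum_le_of_forall_le_of_nonneg (half_pos hε).le fun c _ => ?_
  rw [norm_neg_one_pow_mul]
  refine IsUltrametricDist.norm_sum_le_of_forall_le_of_nonneg (half_pos hε).le fun b _ => ?_
  rw [norm_neg_one_pow_mul, ← dist_eq_norm]
  refine (h ?_).le
  rw [dist_eq_norm, add_sub_cancel_right, norm_mul]
  refine lt_of_le_of_lt (mul_le_of_le_one_right (norm_nonneg _) (PadicInt.norm_le_one _)) ?_
  rw [PadicInt.norm_p_pow]
  refine lt_of_le_of_lt ?_ hM
  have : (1 : ℝ) ≤ p := mod_cast (Fact.out : p.Prime).one_le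
  exact zpow_le_zpow_right₀ this (by lia)

lemma norm_sub_pow_le_of_norm_sub_lt_one {x y : ℤ_[p]} (h : ‖x - y‖ < 1) (n : ℕ) :
    ‖x ^ p ^ n - y ^ p ^ n‖ ≤ ((p : ℝ)⁻¹) ^ n := by
  have h1 := dvd_sub_pow_of_dvd_sub ((PadicInt.norm_lt_one_iff_dvd _).mp h) n
  have h2 := (PadicInt.norm_le_pow_iff_mem_span_pow _ _).mpr (Ideal.mem_span_singleton.mpr h1)
  refine h2.trans ?_
  have : (1 : ℝ) ≤ p := mod_cast (Fact.out : p.Prime).one_le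
  rw [inv_pow, ← zpow_natCast, ← zpow_neg]
  exact zpow_le_zpow_right₀ this (by push_cast; lia)

lemma norm_pow_prime_sub_self_lt_one (x : ℤ_[p]) : ‖x ^ p - x‖ < 1 := by
  rw [← PadicInt.mem_nonunits, ← IsLocalRing.mem_maximalIdeal, ← PadicInt.ker_toZMod,
    RingHom.mem_ker, map_sub, map_pow, ZMod.pow_card, sub_self]

lemma tendsto_inv_pow_prime : Tendsto (fun n : ℕ => ((p : ℝ)⁻¹) ^ n) atTop (𝓝 0) :=
  tendsto_pow_atTop_nhds_zero_of_lt_one (by positivity)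
    (inv_lt_one_of_one_lt₀ (mod_cast (Fact.out : p.Prime).one_lt))

lemma norm_eq_one_of_norm_sub_lt_one {x y : ℚ_[p]} (hx : ‖x‖ = 1) (h : ‖y - x‖ < 1) :
    ‖y‖ = 1 := by
  have := IsUltrametricDist.norm_add_eq_max_of_norm_ne_norm (x := y - x) (y := x)
    (by rw [hx]; exact h.ne)
  rw [sub_add_cancel, hx, max_eq_right h.le] at this
  exact this

/-- The sequence `x ^ p ^ n` converges to `teich p x`, which is congruent to `x` mod `p`. -/
lemma tendsto_teich {x : ℚ_[p]} (hx : ‖x‖ = 1) :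
    Tendsto (fun n : ℕ => x ^ p ^ n) atTop (𝓝 (teich p x)) ∧ ‖teich p x - x‖ < 1 := by
  obtain ⟨y, rfl⟩ : ∃ y : ℤ_[p], (y : ℚ_[p]) = x := ⟨⟨x, hx.le⟩, rfl⟩
  have key : ∃ T, Tendsto (fun n : ℕ => (y : ℚ_[p]) ^ p ^ n) atTop (𝓝 T) := by
    apply cauchySeq_tendsto_of_complete
    apply NonarchimedeanAddGroup.cauchySeq_of_tendsto_sub_nhds_zero
    refine squeeze_zero_norm (fun n => ?_) (tendsto_inv_pow_prime (p := p))
    have := norm_sub_pow_le_of_norm_sub_lt_one (norm_pow_prime_sub_self_lt_one y) n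
    rw [← pow_mul, ← pow_succ', PadicInt.norm_def] at this
    exact_mod_cast this
  have hT := tendsto_nhds_limUnder key
  refine ⟨hT, ?_⟩
  have hmod (n : ℕ) : ‖y ^ p ^ n - y‖ < 1 := by
    rw [← PadicInt.mem_nonunits, ← IsLocalRing.mem_maximalIdeal, ← PadicInt.ker_toZMod,
      RingHom.mem_ker, map_sub, map_pow, ZMod.pow_card_pow, sub_self]
  have hev := (hT.sub_const (teich p (y : ℚ_[p]))).norm
  unfold teich at hev
  rw [sub_self, norm_zero] at hev
  obtain ⟨n, hn⟩ := (hev.eventually_lt_const one_pos).exists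
  have hn' : ‖(y : ℚ_[p]) ^ p ^ n - y‖ < 1 := by
    have := hmod n
    rw [PadicInt.norm_def] at this
    exact_mod_cast this
  rw [norm_sub_rev] at hn
  have := (IsUltrametricDist.norm_add_le_max _ _).trans_lt (max_lt hn hn')
  rwa [sub_add_sub_cancel] at this

lemma norm_teich {x : ℚ_[p]} (hx : ‖x‖ = 1) : ‖teich p x‖ = 1 :=
  norm_eq_one_of_norm_sub_lt_one hx (tendsto_teich hx).2

lemma teich_mul {x y : ℚ_[p]} (hx : ‖x‖ = 1) (hy : ‖y‖ = 1) :
    teich p (x * y) = teich p x * teich p y := by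
  refine tendsto_nhds_unique (tendsto_teich (by rw [norm_mul, hx, hy, one_mul])).1 ?_
  simpa only [mul_pow] using (tendsto_teich hx).1.mul (tendsto_teich hy).1

lemma norm_one_add {z : ℚ_[p]} (hz : ‖z‖ < 1) : ‖1 + z‖ = 1 :=
  norm_eq_one_of_norm_sub_lt_one norm_one (by simpa using hz)

lemma teich_one_add {z : ℚ_[p]} (hz : ‖z‖ < 1) : teich p (1 + z) = 1 := by
  refine tendsto_nhds_unique (tendsto_teich (norm_one_add hz)).1 ?_
  obtain ⟨y, rfl⟩ : ∃ y : ℤ_[p], (y : ℚ_[p]) = z := ⟨⟨z, hz.le⟩, rfl⟩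
  rw [tendsto_iff_norm_sub_tendsto_zero]
  refine squeeze_zero (fun _ => norm_nonneg _) (fun n => ?_) (tendsto_inv_pow_prime (p := p))
  have := norm_sub_pow_le_of_norm_sub_lt_one (x := 1 + y) (y := 1) (by simpa using hz) n
  rw [one_pow, PadicInt.norm_def] at this
  exact_mod_cast this

lemma norm_unitPart {x : ℚ_[p]} (hx : x ≠ 0) : ‖unitPart p x‖ = 1 := by
  have hp0 : (p : ℝ) ≠ 0 := mod_cast (Fact.out : p.Prime).ne_zero
  rw [unitPart, norm_mul, Padic.norm_p_zpow, Padic.norm_eq_zpow_neg_valuation hx, ← zpow_add₀ hp0]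
  simp

lemma unitPart_mul_one_add {x z : ℚ_[p]} (hx : x ≠ 0) (hz : ‖z‖ < 1) :
    unitPart p (x * (1 + z)) = unitPart p x * (1 + z) := by
  have h0 : (1 + z) ≠ 0 := norm_pos_iff.mp (by rw [norm_one_add hz]; exact one_pos)
  have hv : (1 + z).valuation = 0 := by
    have h := Padic.norm_eq_zpow_neg_valuation h0
    have h1 : (1 : ℝ) < p := mod_cast (Fact.out : p.Prime).one_lt
    rw [norm_one_add hz, eq_comm, zpow_eq_one_iff_right₀ (by positivity) h1.ne'] at h
    lia
  rw [unitPart, unitPart, Padic.valuation_mul hx h0, hv, add_zero]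
  ring

lemma norm_angle_sub_one_lt {x : ℚ_[p]} (hx : x ≠ 0) : ‖angle p x - 1‖ < 1 := by
  have hu := norm_unitPart hx
  have hT := norm_teich hu
  have h0 : teich p (unitPart p x) ≠ 0 := norm_pos_iff.mp (by rw [hT]; exact one_pos)
  rw [angle, div_sub_one h0, norm_div, hT, div_one, norm_sub_rev]
  exact (tendsto_teich hu).2

lemma angle_mul_one_add {x z : ℚ_[p]} (hx : x ≠ 0) (hz : ‖z‖ < 1) :
    angle p (x * (1 + z)) = angle p x * (1 + z) := by
  rw [angle, unitPart_mul_one_add hx hz, teich_mul (norm_unitPart hx) (norm_one_add hz),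
    teich_one_add hz, mul_one, angle, div_mul_eq_mul_div]

lemma gbinom_intCast (t : ℤ_[p]) (n : ℕ) :
    gbinom p (t : ℚ_[p]) n = ((Ring.choose t n : ℤ_[p]) : ℚ_[p]) := by
  have h := Ring.descPochhammer_eq_factorial_smul_choose t n
  have h0 : (n.factorial : ℚ_[p]) ≠ 0 := mod_cast n.factorial_ne_zero
  rw [gbinom, div_eq_iff h0]
  rw [← Polynomial.aeval_eq_smeval, ← Polynomial.eval_map_algebraMap, descPochhammer_map,
    descPochhammer_eval_eq_prod_range, nsmul_eq_mul, mul_comm] at h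
  have h' := congrArg PadicInt.Coe.ringHom h
  rw [map_prod, map_mul, map_natCast] at h'
  simp only [map_sub, map_natCast] at h'
  exact h'

lemma norm_gbinom_mul_pow_le (t : ℤ_[p]) (z : ℚ_[p]) (n : ℕ) :
    ‖gbinom p (t : ℚ_[p]) n * z ^ n‖ ≤ ‖z‖ ^ n := by
  rw [gbinom_intCast, norm_mul, norm_pow]
  exact mul_le_of_le_one_left (by positivity) (PadicInt.norm_le_one _)

lemma continuous_bpow_one_add {z : ℚ_[p]} (hz : ‖z‖ < 1) :
    Continuous fun t : ℤ_[p] => bpow p (1 + z) (t : ℚ_[p]) := by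
  simp only [bpow, add_sub_cancel_left]
  refine continuous_tsum (u := fun n => ‖z‖ ^ n) (fun n => ?_)
    (summable_geometric_of_lt_one (norm_nonneg _) hz) fun n t => norm_gbinom_mul_pow_le t z n
  simp only [gbinom_intCast]
  exact (continuous_subtype_val.comp (PadicInt.continuous_choose n)).mul continuous_const

lemma bpow_natCast (y : ℚ_[p]) (k : ℕ) : bpow p y ((k : ℤ_[p]) : ℚ_[p]) = y ^ k := by
  simp only [bpow, gbinom_intCast, Ring.choose_natCast]
  simp only [PadicInt.coe_natCast]
  rw [tsum_eq_sum (s := range (k + 1))]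
  · conv_rhs => rw [← sub_add_cancel y 1, add_pow]
    exact sum_congr rfl fun n _ => by ring
  · intro n hn
    rw [Nat.choose_eq_zero_of_lt (by simpa using hn), Nat.cast_zero, zero_mul]

lemma bpow_mul {x y : ℚ_[p]} (hx : ‖x - 1‖ < 1) (hy : ‖y - 1‖ < 1) (t : ℤ_[p]) :
    bpow p (x * y) t = bpow p x t * bpow p y t := by
  have hxy : ‖x * y - 1‖ < 1 := by
    have hx1 : ‖x‖ = 1 := norm_eq_one_of_norm_sub_lt_one norm_one hx
    have := (IsUltrametricDist.norm_add_le_max (x * (y - 1)) (x - 1)).trans_lt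
      (max_lt (by rwa [norm_mul, hx1, one_mul]) hx)
    rwa [show x * y - 1 = x * (y - 1) + (x - 1) by ring]
  have cont {w : ℚ_[p]} (hw : ‖w - 1‖ < 1) : Continuous fun t : ℤ_[p] => bpow p w (t : ℚ_[p]) := by
    simpa using continuous_bpow_one_add hw
  exact congr_fun (PadicInt.denseRange_natCast.equalizer (cont hxy) ((cont hx).mul (cont hy))
    (funext fun k => by simp [bpow_natCast, mul_pow, -PadicInt.coe_natCast])) t

/-- Dominated convergence for the fermionic integral of a series of functions. -/
lemma tendsto_fermSum_tsum {g : ℕ → ℤ_[p] → ℚ_[p]} {E : ℕ → ℚ_[p]} {u : ℕ → ℝ}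
    (hu : Summable u) (hg : ∀ m a, ‖g m a‖ ≤ u m)
    (hE : ∀ m, Tendsto (fermSum p (g m)) atTop (𝓝 (E m))) :
    Summable E ∧ Tendsto (fermSum p fun a => ∑' m, g m a) atTop (𝓝 (∑' m, E m)) := by
  have hb (m N : ℕ) : ‖fermSum p (g m) N‖ ≤ u m :=
    norm_fermSum_le ((norm_nonneg _).trans (hg m 0)) (hg m) N
  refine ⟨Summable.of_norm_bounded hu fun m =>
    le_of_tendsto (hE m).norm (Eventually.of_forall (hb m)), ?_⟩
  have h1 (N : ℕ) : fermSum p (fun a => ∑' m, g m a) N = ∑' m, fermSum p (g m) N := by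
    simp only [fermSum, ← tsum_mul_left]
    exact (Summable.tsum_finsetSum (f := fun (a : ℕ) m => (-1 : ℚ_[p]) ^ a * g m a) fun a _ =>
      (Summable.of_norm_bounded hu fun m => hg m a).mul_left _).symm
  simp only [funext h1]
  exact tendsto_tsum_of_dominated_convergence hu hE
    (Eventually.of_forall fun N m => hb m N)

lemma fermSum_const_mul (c : ℚ_[p]) (g : ℤ_[p] → ℚ_[p]) (N : ℕ) :
    fermSum p (fun a => c * g a) N = c * fermSum p g N := by
  simp only [fermSum, mul_sum]
  exact sum_congr rfl fun _ _ => mul_left_comm _ _ _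

end FermionicIntegral

end PZeta

open PZeta

/-- power series expansion of the `p`-adic Hurwitz-type Euler zeta function:
all `E_m^f(0) = ∫_{ℤ_p} f(a)^m dμ₋₁(a)` exist, the fermionic integral
`ζ_{p,E}^f(s,λ) = ∫_{ℤ_p} ⟨λ+f(a)⟩^{1-s} dμ₋₁(a)` exists, `Σ_m C(1-s,m) E_m^f(0) λ^{-m}`
converges, and `ζ_{p,E}^f(s,λ) = ⟨λ⟩^{1-s} Σ_m C(1-s,m) E_m^f(0) λ^{-m}`. -/
theorem zetaE_power_series (p : ℕ) [Fact p.Prime] (hp : Odd p)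
    (f : ℤ_[p] → ℤ_[p]) (hf : Continuous f)
    (lam : ℚ_[p]) (hlam : 1 < ‖lam‖) (s : ℤ_[p]) :
    ∃ (E : ℕ → ℚ_[p]) (I : ℚ_[p]),
      (∀ m : ℕ, Filter.Tendsto (fermSum p fun a => ((f a : ℚ_[p])) ^ m)
        Filter.atTop (nhds (E m))) ∧
      Filter.Tendsto
        (fermSum p fun a => bpow p (angle p (lam + (f a : ℚ_[p]))) (1 - (s : ℚ_[p])))
        Filter.atTop (nhds I) ∧
      Summable (fun m : ℕ => gbinom p (1 - (s : ℚ_[p])) m * E m / lam ^ m) ∧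
      I = bpow p (angle p lam) (1 - (s : ℚ_[p])) *
            ∑' m : ℕ, gbinom p (1 - (s : ℚ_[p])) m * E m / lam ^ m := by
  choose E hE using fun m : ℕ => exists_tendsto_fermSum hp
    (g := fun a => ((f a : ℤ_[p]) : ℚ_[p]) ^ m) ((continuous_subtype_val.comp hf).pow m)
  have hlam0 : lam ≠ 0 := norm_pos_iff.mp (one_pos.trans hlam)
  have hnorm (a : ℤ_[p]) : ‖(f a : ℚ_[p]) / lam‖ ≤ ‖lam‖⁻¹ := by
    rw [norm_div, div_eq_mul_inv]
    exact mul_le_of_le_one_left (by positivity) (PadicInt.norm_le_one _)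
  have hlt : ‖lam‖⁻¹ < 1 := inv_lt_one_of_one_lt₀ hlam
  obtain ⟨t, ht⟩ : ∃ t : ℤ_[p], (t : ℚ_[p]) = 1 - s := ⟨1 - s, by push_cast; rfl⟩
  rw [← ht]
  have hbpow (a : ℤ_[p]) : bpow p (angle p (lam + (f a : ℚ_[p]))) t =
      bpow p (angle p lam) t * ∑' m, gbinom p t m / lam ^ m * (f a : ℚ_[p]) ^ m := by
    have hz := (hnorm a).trans_lt hlt
    have hdecomp : lam + (f a : ℚ_[p]) = lam * (1 + (f a : ℚ_[p]) / lam) := by field_simp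
    rw [hdecomp, angle_mul_one_add hlam0 hz,
      bpow_mul (norm_angle_sub_one_lt hlam0) (by simpa using hz)]
    congr 1
    simp only [bpow, add_sub_cancel_left, div_pow]
    exact tsum_congr fun m => by ring
  obtain ⟨hsum, hlim⟩ := tendsto_fermSum_tsum
    (g := fun m a => gbinom p t m / lam ^ m * (f a : ℚ_[p]) ^ m)
    (E := fun m => gbinom p t m / lam ^ m * E m)
    (summable_geometric_of_lt_one (by positivity) hlt)
    (fun m a => by
      have := norm_gbinom_mul_pow_le t ((f a : ℚ_[p]) / lam) m
      rw [div_pow, mul_div_assoc', ← div_mul_eq_mul_div] at this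
      exact this.trans (pow_le_pow_left₀ (norm_nonneg _) (hnorm a) m))
    (fun m => by
      simp only [funext (fermSum_const_mul _ _)]
      exact (hE m).const_mul _)
  simp only [div_mul_eq_mul_div] at hsum hlim hbpow
  refine ⟨E, _, hE, ?_, hsum, rfl⟩
  simp only [hbpow, funext (fermSum_const_mul _ _)]
  exact hlim.const_mul _
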